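/- For all Boolean normal monotonic (BNM) schemes 𝕏, 𝕏', 𝕏'', each of the sets ST(𝕏''), SS(𝕏), TT(𝕏') and SS(𝕏) ∩ TT(𝕏') equals its Tarskian closure, i.e., each satisfies (R), (M), (T) and (S). -/

import Mathlib

namespace ThreeValued

/-- Formulas of the propositional language: countably many variables,
negation, conjunction, disjunction. -/
inductive Fml : Type
  | var : ℕ → Fml
  | neg : Fml → Fml
  | conj : Fml → Fml → Fml
  | disj : Fml → Fml → Fml
deriving DecidableEq

/-- An inference Γ ⇒ φ: a finite set of premises and a conclusion. -/
structure Infer : Type where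
  prem : Finset Fml
  concl : Fml

/-- A set of inferences is closed under transitivity:
whenever there is a nonempty Δ with Δ ⇒ φ ∈ L and Γ ⇒ δ ∈ L for all δ ∈ Δ,
then Γ ⇒ φ ∈ L. -/
def TransClosed (L : Set Infer) : Prop :=
  ∀ (Γ Δ : Finset Fml) (φ : Fml), Δ.Nonempty →
    (⟨Δ, φ⟩ : Infer) ∈ L → (∀ δ ∈ Δ, (⟨Γ, δ⟩ : Infer) ∈ L) → (⟨Γ, φ⟩ : Infer) ∈ L

/-- The transitive closure of a set of inferences: the least superset closed
under transitivity. -/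
def T (L : Set Infer) : Set Infer := ⋂₀ {L' : Set Infer | L ⊆ L' ∧ TransClosed L'}

/-- A set of inferences is open under dual transitivity:
whenever there is a nonempty Δ with Δ ⇒ φ ∉ L and Γ ⇒ δ ∉ L for all δ ∈ Δ,
then Γ ⇒ φ ∉ L. -/
def DualTransClosed (L : Set Infer) : Prop :=
  ∀ (Γ Δ : Finset Fml) (φ : Fml), Δ.Nonempty →
    (⟨Δ, φ⟩ : Infer) ∉ L → (∀ δ ∈ Δ, (⟨Γ, δ⟩ : Infer) ∉ L) → (⟨Γ, φ⟩ : Infer) ∉ L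

/-- The dual transitive closure: the greatest subset open under dual
transitivity. -/
def Td (L : Set Infer) : Set Infer := ⋃₀ {L' : Set Infer | L' ⊆ L ∧ DualTransClosed L'}

/-- The three truth values 0, 1/2, 1. -/
inductive V3 : Type
  | zero | half | one
deriving DecidableEq

/-- A three-valued scheme: a triple of truth functions for ¬, ∧ and ∨. -/
structure Scheme : Type where
  fneg : V3 → V3
  fconj : V3 → V3 → V3
  fdisj : V3 → V3 → V3

/-- Boolean normality: on Boolean inputs the operations agree with the
classical ones. -/
def BooleanNormal (X : Scheme) : Prop :=
  X.fneg .zero = .one ∧ X.fneg .one = .zero ∧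
  X.fconj .one .one = .one ∧ X.fconj .one .zero = .zero ∧
  X.fconj .zero .one = .zero ∧ X.fconj .zero .zero = .zero ∧
  X.fdisj .one .one = .one ∧ X.fdisj .one .zero = .one ∧
  X.fdisj .zero .one = .one ∧ X.fdisj .zero .zero = .zero

/-- The information order: 1/2 is below 0 and below 1. -/
def infLe (a b : V3) : Prop := a = .half ∨ a = b

/-- Monotonicity of a scheme with respect to the information order. -/
def Monotonic (X : Scheme) : Prop :=
  (∀ a b, infLe a b → infLe (X.fneg a) (X.fneg b)) ∧
  (∀ a₁ a₂ b₁ b₂, infLe a₁ b₁ → infLe a₂ b₂ → infLe (X.fconj a₁ a₂) (X.fconj b₁ b₂)) ∧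
  (∀ a₁ a₂ b₁ b₂, infLe a₁ b₁ → infLe a₂ b₂ → infLe (X.fdisj a₁ a₂) (X.fdisj b₁ b₂))

/-- Boolean normal monotonic schemes. -/
def BNM (X : Scheme) : Prop := BooleanNormal X ∧ Monotonic X

/-- Valuations respecting a scheme. -/
def Respects (X : Scheme) (v : Fml → V3) : Prop :=
  (∀ φ, v (.neg φ) = X.fneg (v φ)) ∧
  (∀ φ ψ, v (.conj φ ψ) = X.fconj (v φ) (v ψ)) ∧
  (∀ φ ψ, v (.disj φ ψ) = X.fdisj (v φ) (v ψ))

/-- The strict formula-standard s = {1}. -/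
def sStd : Set V3 := {.one}

/-- The tolerant formula-standard t = {1, 1/2}. -/
def tStd : Set V3 := {.one, .half}

/-- An inference is xy-valid over a scheme X if every valuation respecting X
whose value on each premise is in x gives the conclusion a value in y. -/
def Valid (X : Scheme) (x y : Set V3) (I : Infer) : Prop :=
  ∀ v : Fml → V3, Respects X v → (∀ γ ∈ I.prem, v γ ∈ x) → v I.concl ∈ y

/-- The ss-valid inferences over X. -/
def SS (X : Scheme) : Set Infer := {I | Valid X sStd sStd I}

/-- The tt-valid inferences over X. -/
def TT (X : Scheme) : Set Infer := {I | Valid X tStd tStd I}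

/-- The st-valid inferences over X. -/
def ST (X : Scheme) : Set Infer := {I | Valid X sStd tStd I}

/-- The ts-valid inferences over X. -/
def TS (X : Scheme) : Set Infer := {I | Valid X tStd sStd I}

/-- Classical two-valued valuations. -/
def RespectsCL (v : Fml → Bool) : Prop :=
  (∀ φ, v (.neg φ) = ! v φ) ∧
  (∀ φ ψ, v (.conj φ ψ) = (v φ && v ψ)) ∧
  (∀ φ ψ, v (.disj φ ψ) = (v φ || v ψ))

/-- The classically valid inferences. -/
def CL : Set Infer :=
  {I | ∀ v : Fml → Bool, RespectsCL v → (∀ γ ∈ I.prem, v γ = true) → v I.concl = true}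

/-- Substitution: the homomorphic extension of a map from variables to
formulas. -/
def subst (σ : ℕ → Fml) : Fml → Fml
  | .var n => σ n
  | .neg φ => .neg (subst σ φ)
  | .conj φ ψ => .conj (subst σ φ) (subst σ ψ)
  | .disj φ ψ => .disj (subst σ φ) (subst σ ψ)

/-- Reflexivity. -/
def PropR (L : Set Infer) : Prop := ∀ φ : Fml, (⟨{φ}, φ⟩ : Infer) ∈ L

/-- Monotonicity (weakening). -/
def PropM (L : Set Infer) : Prop :=
  ∀ (Γ Sg : Finset Fml) (φ : Fml), (⟨Γ, φ⟩ : Infer) ∈ L → Γ ⊆ Sg → (⟨Sg, φ⟩ : Infer) ∈ L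

/-- Structurality (closure under substitutions). -/
def PropS (L : Set Infer) : Prop :=
  ∀ (Γ : Finset Fml) (φ : Fml), (⟨Γ, φ⟩ : Infer) ∈ L →
    ∀ σ : ℕ → Fml, (⟨Γ.image (subst σ), subst σ φ⟩ : Infer) ∈ L

/-- The Tarskian closure: the least superset satisfying (R), (M), (T), (S). -/
def Tar (L : Set Infer) : Set Infer :=
  ⋂₀ {L' : Set Infer | L ⊆ L' ∧ PropR L' ∧ PropM L' ∧ TransClosed L' ∧ PropS L'}

/-- L⋆: the inferences whose premise set is an antitheorem of L or whose
conclusion is a theorem of L. -/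
def starL (L : Set Infer) : Set Infer :=
  {I | (∀ ψ : Fml, (⟨I.prem, ψ⟩ : Infer) ∈ L) ∨ (∀ Δ : Finset Fml, (⟨Δ, I.concl⟩ : Infer) ∈ L)}

/-- The propositional variables occurring in a formula. -/
def fvars : Fml → Finset ℕ
  | .var n => {n}
  | .neg φ => fvars φ
  | .conj φ ψ => fvars φ ∪ fvars ψ
  | .disj φ ψ => fvars φ ∪ fvars ψ

theorem Tar_eq_self {L : Set Infer} (hR : PropR L) (hM : PropM L) (hT : TransClosed L)
    (hS : PropS L) : Tar L = L :=
  Set.Subset.antisymm (fun _ h => h L ⟨Set.Subset.rfl, hR, hM, hT, hS⟩)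
    (fun _ h _ hL' => hL'.1 h)

theorem Respects.comp_subst {X : Scheme} {v : Fml → V3} (hv : Respects X v) (σ : ℕ → Fml) :
    Respects X (fun φ => v (subst σ φ)) :=
  ⟨fun _ => hv.1 _, fun _ _ => hv.2.1 _ _, fun _ _ => hv.2.2 _ _⟩

theorem sStd_subset_tStd : sStd ⊆ tStd := fun _ h => Or.inl h

theorem propR_valid (X : Scheme) {x y : Set V3} (hxy : x ⊆ y) :
    PropR {I | Valid X x y I} :=
  fun φ _ _ h => hxy (h φ (Finset.mem_singleton_self φ))

theorem propM_valid (X : Scheme) (x y : Set V3) : PropM {I | Valid X x y I} :=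
  fun _ _ _ hΓ hsub v hv h => hΓ v hv fun γ hγ => h γ (hsub hγ)

theorem propS_valid (X : Scheme) (x y : Set V3) : PropS {I | Valid X x y I} :=
  fun _ _ hΓ σ _ hv h =>
    hΓ _ (hv.comp_subst σ) fun _ hγ => h _ (Finset.mem_image_of_mem _ hγ)

theorem transClosed_valid_self (X : Scheme) (x : Set V3) :
    TransClosed {I | Valid X x x I} :=
  fun _ _ _ _ hΔ hΓ v hv h => hΔ v hv fun δ hδ => hΓ δ hδ v hv h

/-- The valuation respecting `X` determined by its values on the variables. -/
def Scheme.eval (X : Scheme) (f : ℕ → V3) : Fml → V3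
  | .var n => f n
  | .neg φ => X.fneg (X.eval f φ)
  | .conj φ ψ => X.fconj (X.eval f φ) (X.eval f ψ)
  | .disj φ ψ => X.fdisj (X.eval f φ) (X.eval f ψ)

theorem Scheme.respects_eval (X : Scheme) (f : ℕ → V3) : Respects X (X.eval f) :=
  ⟨fun _ => rfl, fun _ _ => rfl, fun _ _ => rfl⟩

theorem BooleanNormal.eval_ne_half {X : Scheme} (hX : BooleanNormal X) {f : ℕ → V3}
    (hf : ∀ n, f n ≠ .half) (φ : Fml) : X.eval f φ ≠ .half := by
  obtain ⟨n0, n1, c11, c10, c01, c00, d11, d10, d01, d00⟩ := hX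
  induction φ with
  | var n => exact hf n
  | neg φ ih =>
    simp only [Scheme.eval]
    cases h : X.eval f φ <;> simp_all
  | conj φ ψ ih₁ ih₂ =>
    simp only [Scheme.eval]
    cases h : X.eval f φ <;> cases h' : X.eval f ψ <;> simp_all
  | disj φ ψ ih₁ ih₂ =>
    simp only [Scheme.eval]
    cases h : X.eval f φ <;> cases h' : X.eval f ψ <;> simp_all

theorem Monotonic.infLe_eval {X : Scheme} (hX : Monotonic X) {v : Fml → V3}
    (hv : Respects X v) {f : ℕ → V3} (hf : ∀ n, infLe (v (.var n)) (f n)) (φ : Fml) :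
    infLe (v φ) (X.eval f φ) := by
  induction φ with
  | var n => exact hf n
  | neg φ ih => rw [hv.1]; exact hX.1 _ _ ih
  | conj φ ψ ih₁ ih₂ => rw [hv.2.1]; exact hX.2.1 _ _ _ _ ih₁ ih₂
  | disj φ ψ ih₁ ih₂ => rw [hv.2.2]; exact hX.2.2 _ _ _ _ ih₁ ih₂

/-- Every valuation respecting a BNM scheme can be sharpened to a Boolean one. -/
theorem BNM.exists_boolean_refinement {X : Scheme} (hX : BNM X) {v : Fml → V3}
    (hv : Respects X v) :
    ∃ w, Respects X w ∧ (∀ φ, w φ ≠ .half) ∧ ∀ φ, infLe (v φ) (w φ) := by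
  refine ⟨X.eval fun n => if v (.var n) = .half then .one else v (.var n),
    X.respects_eval _, hX.1.eval_ne_half fun n => ?_, hX.2.infLe_eval hv fun n => ?_⟩
  · split_ifs with h
    · simp
    · exact h
  · split_ifs with h
    · exact Or.inl h
    · exact Or.inr rfl

theorem BNM.transClosed_ST {X : Scheme} (hX : BNM X) : TransClosed (ST X) := by
  intro Γ Δ φ _ hΔ hΓ v hv h
  obtain ⟨w, hw, hw_bool, hvw⟩ := hX.exists_boolean_refinement hv
  have hwΓ : ∀ γ ∈ Γ, w γ ∈ sStd := fun γ hγ => by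
    have hγ1 : v γ = .one := h γ hγ
    rcases hvw γ with h' | h'
    · simp [hγ1] at h'
    · exact h'.symm.trans hγ1
  have hwφ : w φ ∈ tStd :=
    hΔ w hw fun δ hδ => (hΓ δ hδ w hw hwΓ).resolve_right (hw_bool δ)
  have hwφ1 : w φ = .one := hwφ.resolve_right (hw_bool φ)
  rcases hvw φ with h' | h'
  · exact Or.inr h'
  · exact Or.inl (h'.trans hwφ1)

theorem Tar_valid_self (X : Scheme) (x : Set V3) :
    Tar {I | Valid X x x I} = {I | Valid X x x I} :=
  Tar_eq_self (propR_valid X Set.Subset.rfl) (propM_valid X x x) (transClosed_valid_self X x)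
    (propS_valid X x x)

theorem Tar_inter {L L' : Set Infer} (h : Tar L = L) (h' : Tar L' = L') :
    Tar (L ∩ L') = L ∩ L' := by
  refine Set.Subset.antisymm (fun I hI => ⟨?_, ?_⟩) fun I hI K hK => hK.1 hI
  · rw [← h]; exact fun K hK => hI K ⟨Set.inter_subset_left.trans hK.1, hK.2⟩
  · rw [← h']; exact fun K hK => hI K ⟨Set.inter_subset_right.trans hK.1, hK.2⟩

/-- ST, SS, TT and SS ∩ TT over (possibly different) BNM schemes are all
Tarskian. -/
theorem stmt15 : ∀ X X' X'' : Scheme, BNM X → BNM X' → BNM X'' →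
    Tar (ST X'') = ST X'' ∧ Tar (SS X) = SS X ∧ Tar (TT X') = TT X' ∧
    Tar (SS X ∩ TT X') = SS X ∩ TT X' := by
  intro X X' X'' _ _ hX''
  exact ⟨Tar_eq_self (propR_valid X'' sStd_subset_tStd) (propM_valid X'' _ _) hX''.transClosed_ST
    (propS_valid X'' _ _), Tar_valid_self X _, Tar_valid_self X' _,
    Tar_inter (Tar_valid_self X _) (Tar_valid_self X' _)⟩

end ThreeValued
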